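/- For all real numbers a, b with a² + b² < 1, writing β = √(1 − a² − b²), one has (1/π)·∫₀^{2π} cos(t)·sin(t) / (1 + a·cos(t) + b·sin(t)) dt = 2ab/(β·(1 + β)²). -/

import Mathlib

open Real

lemma one_add_mul_cos_add_mul_sin_pos {a b : ℝ} (h : a ^ 2 + b ^ 2 < 1) (t : ℝ) :
    0 < 1 + a * Real.cos t + b * Real.sin t := by
  have h1 : (a * Real.cos t + b * Real.sin t) ^ 2 < 1 := by
    nlinarith [sq_nonneg (a * Real.sin t - b * Real.cos t), Real.sin_sq_add_cos_sq t]
  linarith [(abs_lt.mp ((sq_lt_one_iff_abs_lt_one _).mp h1)).1]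

/-- A primitive of `1 / (1 + a cos t + b sin t)` valid on the whole real line. -/
lemma hasDerivAt_primitive_inv_one_add_mul_cos_add_mul_sin {a b β : ℝ} (hβ : 0 < β)
    (h : β ^ 2 = 1 - a ^ 2 - b ^ 2) (t : ℝ) :
    HasDerivAt (fun t => (t + 2 * Real.arctan ((b * Real.cos t - a * Real.sin t) /
        (1 + β + (a * Real.cos t + b * Real.sin t)))) / β)
      (1 / (1 + a * Real.cos t + b * Real.sin t)) t := by
  have hD := one_add_mul_cos_add_mul_sin_pos (a := a) (b := b) (by nlinarith) t
  have hE : 0 < 1 + β + (a * Real.cos t + b * Real.sin t) := by linarith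
  have hC : HasDerivAt (fun t => 1 + β + (a * Real.cos t + b * Real.sin t))
      (a * -Real.sin t + b * Real.cos t) t :=
    (((Real.hasDerivAt_cos t).const_mul a).add ((Real.hasDerivAt_sin t).const_mul b)).const_add _
  have hS : HasDerivAt (fun t => b * Real.cos t - a * Real.sin t)
      (b * -Real.sin t - a * Real.cos t) t :=
    ((Real.hasDerivAt_cos t).const_mul b).sub ((Real.hasDerivAt_sin t).const_mul a)
  have key := ((hasDerivAt_id t).add (((hS.div hC hE.ne').arctan).const_mul 2)).div_const β
  refine key.congr_deriv ?_
  have hsc := Real.sin_sq_add_cos_sq t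
  simp only [Pi.div_apply]
  generalize Real.sin t = s at *
  generalize Real.cos t = c at *
  have hden : (1 + β + (a * c + b * s)) ^ 2 + (b * c - a * s) ^ 2
      = 2 * (1 + β) * (1 + a * c + b * s) := by
    linear_combination (a ^ 2 + b ^ 2) * hsc + h
  have hnum : (b * -s - a * c) * (1 + β + (a * c + b * s)) - (b * c - a * s) * (a * -s + b * c)
      = -((1 + β) * (a * c + b * s + 1 - β)) := by
    linear_combination -(a ^ 2 + b ^ 2) * hsc - h
  have hA : 1 / (1 + ((b * c - a * s) / (1 + β + (a * c + b * s))) ^ 2) *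
      (((b * -s - a * c) * (1 + β + (a * c + b * s)) - (b * c - a * s) * (a * -s + b * c)) /
        (1 + β + (a * c + b * s)) ^ 2) = -(a * c + b * s + 1 - β) / (2 * (1 + a * c + b * s)) := by
    have : 1 + ((b * c - a * s) / (1 + β + (a * c + b * s))) ^ 2
        = 2 * (1 + β) * (1 + a * c + b * s) / (1 + β + (a * c + b * s)) ^ 2 := by
      rw [← hden, add_div, div_self (pow_ne_zero 2 hE.ne'), div_pow]
    rw [this, hnum]
    field_simp
  rw [hA]
  field_simp
  ring

lemma integral_inv_one_add_mul_cos_add_mul_sin {a b β : ℝ} (hβ : 0 < β)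
    (h : β ^ 2 = 1 - a ^ 2 - b ^ 2) :
    ∫ t in (0 : ℝ)..(2 * π), 1 / (1 + a * Real.cos t + b * Real.sin t) = 2 * π / β := by
  have hD := one_add_mul_cos_add_mul_sin_pos (a := a) (b := b) (by nlinarith)
  rw [intervalIntegral.integral_eq_sub_of_hasDerivAt
    (fun t _ => hasDerivAt_primitive_inv_one_add_mul_cos_add_mul_sin hβ h t)
    (Continuous.intervalIntegrable
      (continuous_const.div (by fun_prop) fun t => (hD t).ne') _ _)]
  simp
  ring

lemma integral_cos_mul_sin_div_one_add_mul_cos_add_mul_sin {a b β : ℝ} (hβ : 0 < β)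
    (h : β ^ 2 = 1 - a ^ 2 - b ^ 2) :
    (a ^ 2 + b ^ 2) ^ 2 * ∫ t in (0 : ℝ)..(2 * π),
        Real.cos t * Real.sin t / (1 + a * Real.cos t + b * Real.sin t) =
      2 * π * a * b * (1 - β) ^ 2 / β := by
  have hD := one_add_mul_cos_add_mul_sin_pos (a := a) (b := b) (by nlinarith)
  have hder : ∀ t : ℝ, HasDerivAt (fun t => 2 * a * b * (a * Real.sin t - b * Real.cos t - t) +
      (b ^ 2 - a ^ 2) * (1 + a * Real.cos t + b * Real.sin t -
        Real.log (1 + a * Real.cos t + b * Real.sin t)))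
      ((a ^ 2 + b ^ 2) ^ 2 * (Real.cos t * Real.sin t / (1 + a * Real.cos t + b * Real.sin t)) -
        a * b * (2 - a ^ 2 - b ^ 2) * (1 / (1 + a * Real.cos t + b * Real.sin t))) t := by
    intro t
    have hC : HasDerivAt (fun t => 1 + a * Real.cos t + b * Real.sin t)
        (a * -Real.sin t + b * Real.cos t) t :=
      (((Real.hasDerivAt_cos t).const_mul a).const_add 1).add
        ((Real.hasDerivAt_sin t).const_mul b)
    have hS : HasDerivAt (fun t => a * Real.sin t - b * Real.cos t - t)
        (a * Real.cos t - b * -Real.sin t - 1) t :=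
      (((Real.hasDerivAt_sin t).const_mul a).sub
        ((Real.hasDerivAt_cos t).const_mul b)).sub (hasDerivAt_id t)
    refine ((hS.const_mul (2 * a * b)).add
      ((hC.sub (hC.log (hD t).ne')).const_mul (b ^ 2 - a ^ 2))).congr_deriv ?_
    have hDt := (hD t).ne'
    have hsc := Real.sin_sq_add_cos_sq t
    generalize Real.sin t = s at *
    generalize Real.cos t = c at *
    field_simp
    linear_combination (a * b * (a ^ 2 + b ^ 2)) * hsc
  have hi1 : IntervalIntegrable
      (fun t => Real.cos t * Real.sin t / (1 + a * Real.cos t + b * Real.sin t))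
      MeasureTheory.volume 0 (2 * π) :=
    Continuous.intervalIntegrable
      (Continuous.div (by fun_prop) (by fun_prop) fun t => (hD t).ne') _ _
  have hi2 : IntervalIntegrable
      (fun t => 1 / (1 + a * Real.cos t + b * Real.sin t)) MeasureTheory.volume 0 (2 * π) :=
    Continuous.intervalIntegrable
      (Continuous.div (by fun_prop) (by fun_prop) fun t => (hD t).ne') _ _
  have key := intervalIntegral.integral_eq_sub_of_hasDerivAt (fun t _ => hder t)
    ((hi1.const_mul _).sub (hi2.const_mul _))
  rw [intervalIntegral.integral_sub (hi1.const_mul _) (hi2.const_mul _),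
    intervalIntegral.integral_const_mul, intervalIntegral.integral_const_mul,
    integral_inv_one_add_mul_cos_add_mul_sin hβ h] at key
  simp only [Real.cos_two_pi, Real.sin_two_pi, Real.cos_zero, Real.sin_zero] at key
  rw [sub_eq_iff_eq_add.mp key]
  field_simp
  linear_combination -(2 * π * a * b) * h

/-- Proposition 3.1 (σ₁₂ entry): for `a² + b² < 1`, writing `β = √(1 − a² − b²)`,
`(1/π)·∫₀^{2π} cos t·sin t / (1 + a·cos t + b·sin t) dt = 2ab/(β·(1 + β)²)`. -/
theorem randers_symbol_sigma12 (a b : ℝ) (h : a ^ 2 + b ^ 2 < 1) :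
    (1 / π) * ∫ t in (0 : ℝ)..(2 * π),
        Real.cos t * Real.sin t / (1 + a * Real.cos t + b * Real.sin t) =
      2 * a * b /
        (Real.sqrt (1 - a ^ 2 - b ^ 2) * (1 + Real.sqrt (1 - a ^ 2 - b ^ 2)) ^ 2) := by
  have hβ : 0 < Real.sqrt (1 - a ^ 2 - b ^ 2) := Real.sqrt_pos.mpr (by linarith)
  have hβ2 := Real.sq_sqrt (show 0 ≤ 1 - a ^ 2 - b ^ 2 by linarith)
  generalize Real.sqrt (1 - a ^ 2 - b ^ 2) = β at *
  have key := integral_cos_mul_sin_div_one_add_mul_cos_add_mul_sin hβ hβ2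
  by_cases hr : a ^ 2 + b ^ 2 = 0
  · obtain rfl : a = 0 := by nlinarith [sq_nonneg a, sq_nonneg b]
    obtain rfl : b = 0 := by nlinarith [sq_nonneg b]
    simp [mul_comm (Real.cos _), integral_sin_mul_cos₁]
  · have hr2 : a ^ 2 + b ^ 2 = (1 - β) * (1 + β) := by linear_combination hβ2
    have h1 : 1 - β ≠ 0 := fun h0 => hr (by rw [hr2, h0, zero_mul])
    rw [hr2] at key
    generalize (∫ t in (0 : ℝ)..(2 * π),
      Real.cos t * Real.sin t / (1 + a * Real.cos t + b * Real.sin t)) = I at *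
    have hπ := Real.pi_pos
    rw [eq_div_iff hβ.ne'] at key
    rw [eq_div_iff (by positivity)]
    field_simp
    apply mul_left_cancel₀ (pow_ne_zero 2 h1)
    linear_combination key
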